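/- arXiv:1809.01447 — 2 statements merged into one kernel-verified Lean document; each statement's English description precedes it below -/
import Mathlib

section
/- Let U ⊆ ℝ³ × ℝ be an open set, let H : U → ℝ³ be continuous, and let v = (v₁,v₂) : U → ℝ² be C². Write h = 1 + v₁² + v₂² and d = Ψ ∘ v : U → ℝ³. Suppose that at every point of U, v satisfies the projected harmonic map heat flow system ∂ₜv = Δv − 2∇v·∇(log h) + (2|∇v|²/h) v + (h²/4)(H·d) (DΨ(v))ᵀH, where ∇v·∇(log h) ∈ ℝ² has j-th entry ∑ₖ ∂ₖv_j ∂ₖ(log h) and (DΨ(v))ᵀH ∈ ℝ² has j-th entry ∑ᵢ (∂Ψᵢ/∂v_j)(v) Hᵢ. Then at every point of U, d satisfies |d| = 1 and ∂ₜd − Δd = |∇d|² d + (H·d)H − (H·d)² d. -/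
noncomputable section

/-- Space-time `ℝ³ × ℝ`. -/
abbrev SpaceTime := (Fin 3 → ℝ) × ℝ

/-- Euclidean dot product on `ℝ³`. -/
def dot3 (a b : Fin 3 → ℝ) : ℝ := ∑ i, a i * b i

/-- Time partial derivative `∂ₜu`. -/
def pt (u : SpaceTime → ℝ) (p : SpaceTime) : ℝ :=
  lineDeriv ℝ u p ((0 : Fin 3 → ℝ), (1 : ℝ))

/-- Spatial partial derivative `∂ₖu`. -/
def px (k : Fin 3) (u : SpaceTime → ℝ) (p : SpaceTime) : ℝ :=
  lineDeriv ℝ u p (Pi.single k 1, (0 : ℝ))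

/-- Spatial Laplacian `Δu = ∑ₖ ∂ₖ∂ₖu`. -/
def lap (u : SpaceTime → ℝ) (p : SpaceTime) : ℝ := ∑ k, px k (px k u) p

/-- `|∇d|²`, the sum of the squares of all spatial partial derivatives of all components. -/
def gradSq (d : SpaceTime → Fin 3 → ℝ) (p : SpaceTime) : ℝ :=
  ∑ i, ∑ k, (px k (fun q => d q i) p) ^ 2

/-- `u` is C² on `U`: `u`, `∂ₜu` and all first and second spatial partial derivatives
exist and are continuous on `U`. -/
def IsC2On (u : SpaceTime → ℝ) (U : Set SpaceTime) : Prop :=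
  ContinuousOn u U ∧
  (∀ p ∈ U, LineDifferentiableAt ℝ u p ((0 : Fin 3 → ℝ), (1 : ℝ))) ∧
  ContinuousOn (pt u) U ∧
  (∀ k : Fin 3,
    (∀ p ∈ U, LineDifferentiableAt ℝ u p (Pi.single k 1, (0 : ℝ))) ∧
    ContinuousOn (px k u) U) ∧
  (∀ k l : Fin 3,
    (∀ p ∈ U, LineDifferentiableAt ℝ (px l u) p (Pi.single k 1, (0 : ℝ))) ∧
    ContinuousOn (px k (px l u)) U)

/-- Inverse stereographic projection `Ψ : ℝ² → S² ⊆ ℝ³`. -/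
def Psi (v : Fin 2 → ℝ) : Fin 3 → ℝ :=
  ![2 * v 0 / (1 + v 0 ^ 2 + v 1 ^ 2),
    2 * v 1 / (1 + v 0 ^ 2 + v 1 ^ 2),
    (1 - v 0 ^ 2 - v 1 ^ 2) / (1 + v 0 ^ 2 + v 1 ^ 2)]

/-- `(∂Ψᵢ/∂v_j)(w)`. -/
def psiD (j : Fin 2) (i : Fin 3) (w : Fin 2 → ℝ) : ℝ :=
  lineDeriv ℝ (fun u => Psi u i) w (Pi.single j 1)

/-- `|∇v|²` for an `ℝ²`-valued map on space-time. -/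
def gradSq2 (v : SpaceTime → Fin 2 → ℝ) (p : SpaceTime) : ℝ :=
  ∑ j : Fin 2, ∑ k : Fin 3, (px k (fun q => v q j) p) ^ 2

/-- The differential of `Psi` at `(a, b)` applied to the vector `(x, y)`. -/
def dPsi (a b x y : ℝ) : Fin 3 → ℝ :=
  ![2 * x / (1 + a ^ 2 + b ^ 2) - 2 * a * (2 * (a * x + b * y)) / (1 + a ^ 2 + b ^ 2) ^ 2,
    2 * y / (1 + a ^ 2 + b ^ 2) - 2 * b * (2 * (a * x + b * y)) / (1 + a ^ 2 + b ^ 2) ^ 2,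
    -2 * (2 * (a * x + b * y)) / (1 + a ^ 2 + b ^ 2) ^ 2]

/-- The second differential of `Psi` at `(a, b)` as a quadratic form in `(x, y)`. -/
def hessPsi (a b x y : ℝ) : Fin 3 → ℝ :=
  ![-4 * x * (2 * (a * x + b * y)) / (1 + a ^ 2 + b ^ 2) ^ 2
      - 4 * a * (x ^ 2 + y ^ 2) / (1 + a ^ 2 + b ^ 2) ^ 2
      + 4 * a * (2 * (a * x + b * y)) ^ 2 / (1 + a ^ 2 + b ^ 2) ^ 3,
    -4 * y * (2 * (a * x + b * y)) / (1 + a ^ 2 + b ^ 2) ^ 2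
      - 4 * b * (x ^ 2 + y ^ 2) / (1 + a ^ 2 + b ^ 2) ^ 2
      + 4 * b * (2 * (a * x + b * y)) ^ 2 / (1 + a ^ 2 + b ^ 2) ^ 3,
    -4 * (x ^ 2 + y ^ 2) / (1 + a ^ 2 + b ^ 2) ^ 2
      + 4 * (2 * (a * x + b * y)) ^ 2 / (1 + a ^ 2 + b ^ 2) ^ 3]

lemma one_add_sq_add_sq_ne_zero (a b : ℝ) : 1 + a ^ 2 + b ^ 2 ≠ 0 := by positivity

lemma dPsi_eq_linear (a b x y : ℝ) (i : Fin 3) :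
    dPsi a b x y i = x * dPsi a b 1 0 i + y * dPsi a b 0 1 i := by
  fin_cases i <;> simp [dPsi] <;> ring

lemma dot3_Psi_self (w : Fin 2 → ℝ) : dot3 (Psi w) (Psi w) = 1 := by
  have h := one_add_sq_add_sq_ne_zero (w 0) (w 1)
  simp only [dot3, Psi, Fin.sum_univ_three, Matrix.cons_val]
  field_simp
  ring

/-- `Psi` is conformal with factor `2 / h`. -/
lemma sum_dPsi_sq (a b x y : ℝ) :
    ∑ i, dPsi a b x y i ^ 2 = 4 * (x ^ 2 + y ^ 2) / (1 + a ^ 2 + b ^ 2) ^ 2 := by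
  have h := one_add_sq_add_sq_ne_zero a b
  simp only [dPsi, Fin.sum_univ_three, Matrix.cons_val]
  field_simp
  ring

/-- Gauss formula for the sphere in stereographic coordinates. -/
lemma hessPsi_eq (w : Fin 2 → ℝ) (x y : ℝ) (i : Fin 3) :
    hessPsi (w 0) (w 1) x y i =
      dPsi (w 0) (w 1) 1 0 i *
          (-2 * (x * (2 * (w 0 * x + w 1 * y) / (1 + w 0 ^ 2 + w 1 ^ 2)))
            + 2 * (x ^ 2 + y ^ 2) / (1 + w 0 ^ 2 + w 1 ^ 2) * w 0)
        + dPsi (w 0) (w 1) 0 1 i *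
          (-2 * (y * (2 * (w 0 * x + w 1 * y) / (1 + w 0 ^ 2 + w 1 ^ 2)))
            + 2 * (x ^ 2 + y ^ 2) / (1 + w 0 ^ 2 + w 1 ^ 2) * w 1)
        - 4 * (x ^ 2 + y ^ 2) / (1 + w 0 ^ 2 + w 1 ^ 2) ^ 2 * Psi w i := by
  have h := one_add_sq_add_sq_ne_zero (w 0) (w 1)
  fin_cases i <;> simp [dPsi, hessPsi, Psi] <;> field_simp <;> ring

/-- `(h² / 4) DΨ DΨᵀ` is the orthogonal projection onto the tangent plane of the sphere. -/
lemma dPsi_mul_transpose (w : Fin 2 → ℝ) (K : Fin 3 → ℝ) (i : Fin 3) :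
    (1 + w 0 ^ 2 + w 1 ^ 2) ^ 2 / 4 *
        (dPsi (w 0) (w 1) 1 0 i * ∑ l, dPsi (w 0) (w 1) 1 0 l * K l
          + dPsi (w 0) (w 1) 0 1 i * ∑ l, dPsi (w 0) (w 1) 0 1 l * K l) =
      K i - dot3 K (Psi w) * Psi w i := by
  have h := one_add_sq_add_sq_ne_zero (w 0) (w 1)
  fin_cases i <;> simp [dPsi, Psi, dot3, Fin.sum_univ_three] <;> field_simp <;> ring

section LineDeriv

variable {E : Type*} [AddCommGroup E] [Module ℝ E] {p e : E}

lemma HasLineDerivAt.Psi_comp {v : E → Fin 2 → ℝ} {x y : ℝ}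
    (h0 : HasLineDerivAt ℝ (fun q => v q 0) x p e)
    (h1 : HasLineDerivAt ℝ (fun q => v q 1) y p e) (i : Fin 3) :
    HasLineDerivAt ℝ (fun q => Psi (v q) i) (dPsi (v p 0) (v p 1) x y i) p e := by
  have h := one_add_sq_add_sq_ne_zero (v p 0) (v p 1)
  unfold HasLineDerivAt at *
  have hh := ((h0.pow 2).const_add 1).add (h1.pow 2)
  fin_cases i
  · refine ((h0.const_mul 2).div hh (by simpa using h)).congr_deriv ?_
    simp [dPsi]
    field_simp
  · refine ((h1.const_mul 2).div hh (by simpa using h)).congr_deriv ?_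
    simp [dPsi]
    field_simp
  · refine ((((h0.pow 2).const_sub 1).sub (h1.pow 2)).div hh (by simpa using h)).congr_deriv ?_
    simp [dPsi]
    field_simp
    ring

lemma HasLineDerivAt.dPsi_comp {a b x y : E → ℝ} {x' y' : ℝ}
    (ha : HasLineDerivAt ℝ a (x p) p e) (hb : HasLineDerivAt ℝ b (y p) p e)
    (hx : HasLineDerivAt ℝ x x' p e) (hy : HasLineDerivAt ℝ y y' p e) (i : Fin 3) :
    HasLineDerivAt ℝ (fun q => dPsi (a q) (b q) (x q) (y q) i)
      (dPsi (a p) (b p) x' y' i + hessPsi (a p) (b p) (x p) (y p) i) p e := by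
  have h := one_add_sq_add_sq_ne_zero (a p) (b p)
  unfold HasLineDerivAt at *
  have hh := ((ha.pow 2).const_add 1).add (hb.pow 2)
  have hs := ((ha.mul hx).add (hb.mul hy)).const_mul 2
  fin_cases i
  · refine (((hx.const_mul 2).div hh (by simpa using h)).sub
      (((ha.const_mul 2).mul hs).div (hh.pow 2) (by simpa using h))).congr_deriv ?_
    simp [dPsi, hessPsi]
    field_simp
    ring
  · refine (((hy.const_mul 2).div hh (by simpa using h)).sub
      (((hb.const_mul 2).mul hs).div (hh.pow 2) (by simpa using h))).congr_deriv ?_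
    simp [dPsi, hessPsi]
    field_simp
    ring
  · refine ((hs.const_mul (-2)).div (hh.pow 2) (by simpa using h)).congr_deriv ?_
    simp [dPsi, hessPsi]
    field_simp
    ring

lemma HasLineDerivAt.log_one_add_sq_add_sq {a b : E → ℝ} {x y : ℝ}
    (ha : HasLineDerivAt ℝ a x p e) (hb : HasLineDerivAt ℝ b y p e) :
    HasLineDerivAt ℝ (fun q => Real.log (1 + a q ^ 2 + b q ^ 2))
      (2 * (a p * x + b p * y) / (1 + a p ^ 2 + b p ^ 2)) p e := by
  have h := one_add_sq_add_sq_ne_zero (a p) (b p)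
  unfold HasLineDerivAt at *
  refine ((((ha.pow 2).const_add 1).add (hb.pow 2)).log (by simpa using h)).congr_deriv ?_
  simp
  ring

end LineDeriv

lemma psiD_zero (i : Fin 3) (w : Fin 2 → ℝ) : psiD 0 i w = dPsi (w 0) (w 1) 1 0 i := by
  refine (HasLineDerivAt.Psi_comp (v := id) ?_ ?_ i).lineDeriv
  · simpa [HasLineDerivAt] using (hasDerivAt_id (0 : ℝ)).const_add (w 0)
  · simpa [HasLineDerivAt] using hasDerivAt_const (0 : ℝ) (w 1)

lemma psiD_one (i : Fin 3) (w : Fin 2 → ℝ) : psiD 1 i w = dPsi (w 0) (w 1) 0 1 i := by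
  refine (HasLineDerivAt.Psi_comp (v := id) ?_ ?_ i).lineDeriv
  · simpa [HasLineDerivAt] using hasDerivAt_const (0 : ℝ) (w 0)
  · simpa [HasLineDerivAt] using (hasDerivAt_id (0 : ℝ)).const_add (w 1)

section Composition

variable {U : Set SpaceTime} {v : SpaceTime → Fin 2 → ℝ} {p : SpaceTime}

lemma pt_Psi_comp (hv : ∀ j : Fin 2, IsC2On (fun q => v q j) U) (hp : p ∈ U) (i : Fin 3) :
    pt (fun q => Psi (v q) i) p =
      dPsi (v p 0) (v p 1) (pt (fun q => v q 0) p) (pt (fun q => v q 1) p) i :=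
  (HasLineDerivAt.Psi_comp ((hv 0).2.1 p hp).hasLineDerivAt
    ((hv 1).2.1 p hp).hasLineDerivAt i).lineDeriv

lemma IsC2On.hasLineDerivAt_px {u : SpaceTime → ℝ} (hu : IsC2On u U) (hp : p ∈ U) (k : Fin 3) :
    HasLineDerivAt ℝ u (px k u p) p (Pi.single k 1, (0 : ℝ)) :=
  ((hu.2.2.2.1 k).1 p hp).hasLineDerivAt

lemma px_Psi_comp (hv : ∀ j : Fin 2, IsC2On (fun q => v q j) U) (hp : p ∈ U)
    (k i : Fin 3) :
    px k (fun q => Psi (v q) i) p =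
      dPsi (v p 0) (v p 1) (px k (fun q => v q 0) p) (px k (fun q => v q 1) p) i :=
  (HasLineDerivAt.Psi_comp ((hv 0).hasLineDerivAt_px hp k)
    ((hv 1).hasLineDerivAt_px hp k) i).lineDeriv

lemma px_px_Psi_comp (hU : IsOpen U) (hv : ∀ j : Fin 2, IsC2On (fun q => v q j) U)
    (hp : p ∈ U) (k i : Fin 3) :
    px k (px k (fun q => Psi (v q) i)) p =
      dPsi (v p 0) (v p 1) (px k (px k (fun q => v q 0)) p) (px k (px k (fun q => v q 1)) p) i
        + hessPsi (v p 0) (v p 1) (px k (fun q => v q 0) p) (px k (fun q => v q 1) p) i := by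
  have hd := HasLineDerivAt.dPsi_comp
    ((hv 0).hasLineDerivAt_px hp k) ((hv 1).hasLineDerivAt_px hp k)
    (((hv 0).2.2.2.2 k k).1 p hp).hasLineDerivAt
    (((hv 1).2.2.2.2 k k).1 p hp).hasLineDerivAt i
  refine (hd.congr_of_eventuallyEq ?_).lineDeriv
  filter_upwards [hU.mem_nhds hp] with q hq using px_Psi_comp hv hq k i

end Composition

/-- If `v` solves the projected harmonic map heat flow system, then `d = Ψ ∘ v` takes values
in the unit sphere and solves `∂ₜd − Δd = |∇d|²d + (H·d)H − (H·d)²d`. -/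
theorem statement0 (U : Set SpaceTime) (hU : IsOpen U)
    (H : SpaceTime → Fin 3 → ℝ) (hH : ContinuousOn H U)
    (v : SpaceTime → Fin 2 → ℝ)
    (hv : ∀ j : Fin 2, IsC2On (fun p => v p j) U)
    (heq : ∀ p ∈ U, ∀ j : Fin 2,
      pt (fun q => v q j) p =
        lap (fun q => v q j) p
          - 2 * ∑ k, px k (fun q => v q j) p
              * px k (fun q => Real.log (1 + (v q 0) ^ 2 + (v q 1) ^ 2)) p
          + 2 * gradSq2 v p / (1 + (v p 0) ^ 2 + (v p 1) ^ 2) * v p j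
          + (1 + (v p 0) ^ 2 + (v p 1) ^ 2) ^ 2 / 4
              * dot3 (H p) (Psi (v p)) * ∑ i, psiD j i (v p) * H p i) :
    ∀ p ∈ U,
      dot3 (Psi (v p)) (Psi (v p)) = 1 ∧
      ∀ i : Fin 3,
        pt (fun q => Psi (v q) i) p - lap (fun q => Psi (v q) i) p =
          gradSq (fun q => Psi (v q)) p * Psi (v p) i
            + dot3 (H p) (Psi (v p)) * H p i
            - (dot3 (H p) (Psi (v p))) ^ 2 * Psi (v p) i := by
  intro p hp
  refine ⟨dot3_Psi_self (v p), fun i => ?_⟩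
  have hlog (k : Fin 3) : px k (fun q => Real.log (1 + (v q 0) ^ 2 + (v q 1) ^ 2)) p =
      2 * (v p 0 * px k (fun q => v q 0) p + v p 1 * px k (fun q => v q 1) p)
        / (1 + v p 0 ^ 2 + v p 1 ^ 2) :=
    (((hv 0).hasLineDerivAt_px hp k).log_one_add_sq_add_sq
      ((hv 1).hasLineDerivAt_px hp k)).lineDeriv
  have e0 := heq p hp 0
  have e1 := heq p hp 1
  simp only [hlog, psiD_zero, psiD_one] at e0 e1
  have hgrad : gradSq (fun q => Psi (v q)) p =
      4 * gradSq2 v p / (1 + v p 0 ^ 2 + v p 1 ^ 2) ^ 2 := by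
    simp only [gradSq, px_Psi_comp hv hp]
    rw [Finset.sum_comm]
    simp only [sum_dPsi_sq]
    simp only [gradSq2, Fin.sum_univ_three, Fin.sum_univ_two]
    ring
  have hproj := dPsi_mul_transpose (v p) (H p) i
  have hlap : lap (fun q => Psi (v q) i) p =
      dPsi (v p 0) (v p 1) (lap (fun q => v q 0) p) (lap (fun q => v q 1) p) i
        + ∑ k, hessPsi (v p 0) (v p 1) (px k (fun q => v q 0) p) (px k (fun q => v q 1) p) i := by
    simp only [lap, px_px_Psi_comp hU hv hp, Finset.sum_add_distrib]
    congr 1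
    simp only [dPsi_eq_linear _ _ (px _ _ _), dPsi_eq_linear _ _ (∑ _, _),
      Finset.sum_add_distrib, Finset.sum_mul]
  rw [pt_Psi_comp hv hp, hlap, hgrad, dPsi_eq_linear _ _ (pt _ _), dPsi_eq_linear _ _ (lap _ _),
    e0, e1]
  simp only [hessPsi_eq, gradSq2, Fin.sum_univ_two, Fin.sum_univ_three] at hproj ⊢
  linear_combination dot3 (H p) (Psi (v p)) * hproj
end
end

section
/- There exists a real-analytic map 𝐇 = (H₁,H₂,H₃) : ℝ² × ℝ² → ℝ³ such that for every (v₁,v₂,f₁,f₂) ∈ ℝ² × ℝ², writing (H₁,H₂,H₃) = 𝐇(v₁,v₂,f₁,f₂) and h = 1 + v₁² + v₂², the following two equations hold: [(2v₁H₁ + 2v₂H₂ + (1 − v₁² − v₂²)H₃)/h] · [½(1 + v₂² − v₁²)H₁ − v₁v₂H₂ − v₁H₃] = f₁ and [(2v₁H₁ + 2v₂H₂ + (1 − v₁² − v₂²)H₃)/h] · [−v₁v₂H₁ + ½(1 + v₁² − v₂²)H₂ − v₂H₃] = f₂. -/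
/-- The field `d + (4 / h²) (f₁ e₁ + f₂ e₂)`, where `d` is the point of the sphere with
stereographic coordinates `v`, `h = 1 + |v|²`, and `e₁, e₂` are the coefficient vectors of the
projected field; they are orthogonal to `d` and to each other, with `|e₁| = |e₂| = h / 2`. -/
noncomputable def stereographicControl (x : (Fin 2 → ℝ) × (Fin 2 → ℝ)) : Fin 3 → ℝ :=
  ![2 * x.1 0 / (1 + x.1 0 ^ 2 + x.1 1 ^ 2)
      + 4 * (x.2 0 * ((1 + x.1 1 ^ 2 - x.1 0 ^ 2) / 2) - x.2 1 * (x.1 0 * x.1 1))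
        / (1 + x.1 0 ^ 2 + x.1 1 ^ 2) ^ 2,
    2 * x.1 1 / (1 + x.1 0 ^ 2 + x.1 1 ^ 2)
      + 4 * (x.2 1 * ((1 + x.1 0 ^ 2 - x.1 1 ^ 2) / 2) - x.2 0 * (x.1 0 * x.1 1))
        / (1 + x.1 0 ^ 2 + x.1 1 ^ 2) ^ 2,
    (1 - x.1 0 ^ 2 - x.1 1 ^ 2) / (1 + x.1 0 ^ 2 + x.1 1 ^ 2)
      - 4 * (x.2 0 * x.1 0 + x.2 1 * x.1 1) / (1 + x.1 0 ^ 2 + x.1 1 ^ 2) ^ 2]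

theorem analyticAt_stereographicControl (x : (Fin 2 → ℝ) × (Fin 2 → ℝ)) :
    AnalyticAt ℝ stereographicControl x := by
  have hv (i : Fin 2) : AnalyticAt ℝ (fun y : (Fin 2 → ℝ) × (Fin 2 → ℝ) => y.1 i) x :=
    ((ContinuousLinearMap.proj (R := ℝ) (φ := fun _ : Fin 2 => ℝ) i).comp
      (ContinuousLinearMap.fst ℝ (Fin 2 → ℝ) (Fin 2 → ℝ))).analyticAt x
  have hf (i : Fin 2) : AnalyticAt ℝ (fun y : (Fin 2 → ℝ) × (Fin 2 → ℝ) => y.2 i) x :=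
    ((ContinuousLinearMap.proj (R := ℝ) (φ := fun _ : Fin 2 => ℝ) i).comp
      (ContinuousLinearMap.snd ℝ (Fin 2 → ℝ) (Fin 2 → ℝ))).analyticAt x
  have hne : 1 + x.1 0 ^ 2 + x.1 1 ^ 2 ≠ 0 := by positivity
  have hne2 : (1 + x.1 0 ^ 2 + x.1 1 ^ 2) ^ 2 ≠ 0 := pow_ne_zero 2 hne
  have hv0 := hv 0
  have hv1 := hv 1
  have hf0 := hf 0
  have hf1 := hf 1
  rw [analyticAt_pi_iff]
  intro i
  fin_cases i <;> simp only [stereographicControl] <;> dsimp <;>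
    fun_prop (disch := assumption)

/-- There is a real-analytic map `𝐇 : ℝ² × ℝ² → ℝ³` solving the underdetermined
algebraic system `(H·d)·(projected field) = f` for all `(v, f)`. -/
theorem statement6 :
    ∃ Hc : (Fin 2 → ℝ) × (Fin 2 → ℝ) → (Fin 3 → ℝ),
      AnalyticOn ℝ Hc Set.univ ∧
      ∀ v f : Fin 2 → ℝ,
        (2 * v 0 * Hc (v, f) 0 + 2 * v 1 * Hc (v, f) 1
            + (1 - v 0 ^ 2 - v 1 ^ 2) * Hc (v, f) 2) / (1 + v 0 ^ 2 + v 1 ^ 2)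
          * ((1 + v 1 ^ 2 - v 0 ^ 2) / 2 * Hc (v, f) 0 - v 0 * v 1 * Hc (v, f) 1
              - v 0 * Hc (v, f) 2) = f 0 ∧
        (2 * v 0 * Hc (v, f) 0 + 2 * v 1 * Hc (v, f) 1
            + (1 - v 0 ^ 2 - v 1 ^ 2) * Hc (v, f) 2) / (1 + v 0 ^ 2 + v 1 ^ 2)
          * (-(v 0 * v 1) * Hc (v, f) 0 + (1 + v 0 ^ 2 - v 1 ^ 2) / 2 * Hc (v, f) 1
              - v 1 * Hc (v, f) 2) = f 1 := by
  refine ⟨stereographicControl, fun x _ => (analyticAt_stereographicControl x).analyticWithinAt,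
    fun v f => ?_⟩
  have hne : 1 + v 0 ^ 2 + v 1 ^ 2 ≠ 0 := by positivity
  simp only [stereographicControl, Matrix.cons_val]
  constructor <;> field_simp <;> ring
end
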